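/- arXiv:2004.10526 — 3 statements merged into one kernel-verified Lean document; each statement's English description precedes it below -/
import Mathlib

section
/- Let m > 3 be an odd integer and let G be defined as below. Then, modulo [m]·Φ_m(q)^3, the following q-congruence of rational functions holds: G(m,2) ≡ -((1+q^3)·q^2/(1+q+q^2)^2)·[m]^3. -/
open Finset Polynomial

/-- The variable `q`, viewed as a rational function over `ℚ`. -/
noncomputable def q : RatFunc ℚ := RatFunc.X

/-- The q-shifted factorial `(a; b)_n = (1-a)(1-ab)⋯(1-ab^{n-1})`. -/
noncomputable def qpoch (a b : RatFunc ℚ) (n : ℕ) : RatFunc ℚ :=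
  ∏ i ∈ Finset.range n, (1 - a * b ^ i)

/-- The q-integer `[m] = (1-q^m)/(1-q)` (for an arbitrary integer `m`). -/
noncomputable def qint (m : ℤ) : RatFunc ℚ := (1 - q ^ m) / (1 - q)

/-- The q-integer `[n] = 1 + q + ⋯ + q^{n-1}` as a polynomial. -/
noncomputable def qintPoly (n : ℕ) : Polynomial ℚ := ∑ i ∈ Finset.range n, Polynomial.X ^ i

/-- The central q-binomial coefficient `[2k choose k] = (q;q)_{2k}/(q;q)_k^2`. -/
noncomputable def qcb (k : ℕ) : RatFunc ℚ := qpoch q q (2 * k) / (qpoch q q k) ^ 2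

/-- Two rational functions are congruent modulo a polynomial `P` iff `P` divides the
numerator of the reduced form of their difference. -/
def ratCongr (A B : RatFunc ℚ) (P : Polynomial ℚ) : Prop := P ∣ (A - B).num

/-- The function `F(n,k)` of the q-WZ pair. -/
noncomputable def F (n : ℕ) (k : ℤ) : RatFunc ℚ :=
  qint (3 * n + 2 * k + 1) * qpoch q (q ^ 2) n * (qpoch (q ^ (2 * k + 1)) (q ^ 2) n) ^ 2 *
    q ^ (-((n : ℤ) * ((n : ℤ) + 1) / 2) - (2 * (n : ℤ) + 1) * k) /
    ((qpoch q q n) ^ 2 * qpoch (q ^ 2) (q ^ 2) n)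

/-- The function `G(n,k)` of the q-WZ pair, with the convention `1/(q^2;q^2)_m = 0`
for negative `m` (so `G(0,k) = 0`). -/
noncomputable def G (n : ℕ) (k : ℤ) : RatFunc ℚ :=
  if n = 0 then 0 else
    -((1 + q ^ ((n : ℤ) + 2 * k - 1)) * qpoch q (q ^ 2) n *
        (qpoch (q ^ (2 * k + 1)) (q ^ 2) (n - 1)) ^ 2 *
        q ^ (-((n : ℤ) * ((n : ℤ) - 1) / 2) - (2 * (n : ℤ) - 1) * k)) /
      ((1 - q) * (qpoch q q (n - 1)) ^ 2 * qpoch (q ^ 2) (q ^ 2) (n - 1))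

open WithZero IsDedekindDomain

/-- The `d`-th cyclotomic polynomial as a height one prime of `ℚ[X]`. -/
noncomputable def cyclotomicPrime (d : ℕ) (hd : 0 < d) : HeightOneSpectrum ℚ[X] where
  asIdeal := Ideal.span {cyclotomic d ℚ}
  isPrime := (Ideal.span_singleton_prime (cyclotomic_ne_zero d ℚ)).2
    (cyclotomic.irreducible_rat hd).prime
  ne_bot := by simpa using cyclotomic_ne_zero d ℚ

/-- The valuation on `ℚ(q)` counting the order of vanishing along the `d`-th cyclotomic
polynomial. -/
noncomputable def cyclotomicVal (d : ℕ) (hd : 0 < d) : Valuation (RatFunc ℚ) ℤᵐ⁰ :=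
  (cyclotomicPrime d hd).valuation (RatFunc ℚ)

section Valuation

variable {d : ℕ} (hd : 0 < d)

theorem cyclotomicVal_algebraMap_le_one (p : ℚ[X]) :
    cyclotomicVal d hd (algebraMap ℚ[X] (RatFunc ℚ) p) ≤ 1 := by
  rw [cyclotomicVal, HeightOneSpectrum.valuation_of_algebraMap]
  exact HeightOneSpectrum.intValuation_le_one _ _

theorem cyclotomicVal_algebraMap_le_iff (p : ℚ[X]) (k : ℕ) :
    cyclotomicVal d hd (algebraMap ℚ[X] (RatFunc ℚ) p) ≤ exp (-(k : ℤ)) ↔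
      cyclotomic d ℚ ^ k ∣ p := by
  rw [cyclotomicVal, HeightOneSpectrum.valuation_of_algebraMap,
    HeightOneSpectrum.intValuation_le_pow_iff_mem, cyclotomicPrime, Ideal.span_singleton_pow,
    Ideal.mem_span_singleton]

theorem cyclotomicVal_algebraMap_eq_one_iff (p : ℚ[X]) :
    cyclotomicVal d hd (algebraMap ℚ[X] (RatFunc ℚ) p) = 1 ↔ ¬ cyclotomic d ℚ ∣ p := by
  rw [cyclotomicVal, HeightOneSpectrum.valuation_of_algebraMap,
    HeightOneSpectrum.intValuation_eq_one_iff, cyclotomicPrime, Ideal.mem_span_singleton]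

theorem cyclotomicVal_cyclotomic (i : ℕ) :
    cyclotomicVal d hd (algebraMap ℚ[X] (RatFunc ℚ) (cyclotomic i ℚ)) =
      if i = d then exp (-1 : ℤ) else 1 := by
  split_ifs with h
  · subst h
    rw [cyclotomicVal, HeightOneSpectrum.valuation_of_algebraMap]
    exact HeightOneSpectrum.intValuation_singleton _ (cyclotomic_ne_zero i ℚ) rfl
  · rw [cyclotomicVal_algebraMap_eq_one_iff]
    intro hdvd
    exact (cyclotomic.irreducible_rat hd).not_isUnit
      ((cyclotomic.isCoprime_rat (Ne.symm h)).isUnit_of_dvd' dvd_rfl hdvd)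

theorem algebraMap_X_eq_q : algebraMap ℚ[X] (RatFunc ℚ) X = q := RatFunc.algebraMap_X

theorem cyclotomicVal_one_sub_q_pow {r : ℕ} (hr : 0 < r) :
    cyclotomicVal d hd (1 - q ^ r) = if d ∣ r then exp (-1 : ℤ) else 1 := by
  rw [← Valuation.map_neg, neg_sub, ← algebraMap_X_eq_q, ← map_pow,
    ← map_one (algebraMap ℚ[X] (RatFunc ℚ)), ← map_sub, ← prod_cyclotomic_eq_X_pow_sub_one hr,
    map_prod, map_prod, Finset.prod_congr rfl fun i _ => cyclotomicVal_cyclotomic hd i,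
    Finset.prod_ite_eq']
  simp [hr.ne']

theorem cyclotomicVal_q : cyclotomicVal d hd q = 1 := by
  rw [← algebraMap_X_eq_q, cyclotomicVal_algebraMap_eq_one_iff]
  intro h
  have h1 : cyclotomic d ℚ ∣ X ^ d - 1 := cyclotomic.dvd_X_pow_sub_one d ℚ
  have h2 : cyclotomic d ℚ ∣ 1 := by
    have := dvd_sub (dvd_pow h hd.ne') h1
    rwa [sub_sub_cancel] at this
  exact (cyclotomic.irreducible_rat hd).not_isUnit (isUnit_of_dvd_one h2)

theorem cyclotomic_pow_dvd_num {f : RatFunc ℚ} {k : ℕ}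
    (hf : cyclotomicVal d hd f ≤ exp (-(k : ℤ))) : cyclotomic d ℚ ^ k ∣ f.num := by
  rw [← cyclotomicVal_algebraMap_le_iff hd]
  have h : algebraMap ℚ[X] (RatFunc ℚ) f.num = f * algebraMap ℚ[X] (RatFunc ℚ) f.denom := by
    rw [← div_eq_iff (RatFunc.algebraMap_ne_zero f.denom_ne_zero), RatFunc.num_div_denom]
  rw [h, map_mul]
  exact (mul_le_of_le_one_right' (cyclotomicVal_algebraMap_le_one hd _)).trans hf

end Valuation

theorem one_sub_q_pow_ne_zero {r : ℕ} (hr : 0 < r) : 1 - q ^ r ≠ 0 := by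
  intro h
  have := cyclotomicVal_one_sub_q_pow one_pos hr
  simp [h, eq_comm (a := (0 : ℤᵐ⁰))] at this

theorem q_ne_zero : q ≠ 0 := RatFunc.X_ne_zero

theorem one_add_q_add_q_sq_mul : (1 + q + q ^ 2) * (1 - q ^ 1) = 1 - q ^ 3 := by ring

theorem qpoch_mul_prod_even (h : ℕ) :
    qpoch q q (2 * h) =
      (∏ i ∈ range h, (1 - q ^ (2 * i + 1))) * ∏ i ∈ range h, (1 - q ^ (2 * i + 2)) := by
  rw [← Finset.prod_mul_distrib]
  induction h with
  | zero => simp [qpoch]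
  | succ h ih =>
    rw [Finset.prod_range_succ, ← ih, qpoch, qpoch, Nat.mul_succ, Finset.prod_range_succ,
      Finset.prod_range_succ]
    ring

theorem qpoch_q_q_sq (n : ℕ) : qpoch q (q ^ 2) n = ∏ i ∈ range n, (1 - q ^ (2 * i + 1)) :=
  Finset.prod_congr rfl fun i _ => by ring

theorem qpoch_q_q_sq_split (h : ℕ) :
    qpoch q (q ^ 2) (2 * h + 1) = (∏ i ∈ range h, (1 - q ^ (2 * i + 1))) *
      (1 - q ^ (2 * h + 1)) * ∏ i ∈ range h, (1 - q ^ (2 * h + 1 + (2 * i + 2))) := by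
  rw [qpoch_q_q_sq, show 2 * h + 1 = (h + 1) + h by ring, Finset.prod_range_add,
    Finset.prod_range_succ]
  congr 1
  · congr 3; ring
  · exact Finset.prod_congr rfl fun i _ => by ring

theorem qpoch_q_sq_split (h : ℕ) :
    qpoch (q ^ 2) (q ^ 2) (2 * h) = (∏ i ∈ range h, (1 - q ^ (2 * i + 2))) *
      ∏ i ∈ range h, (1 - q ^ (2 * h + 1 + (2 * i + 1))) := by
  rw [qpoch, two_mul h, Finset.prod_range_add]
  congr 1 <;> exact Finset.prod_congr rfl fun i _ => by ring

theorem qpoch_q_five (n : ℕ) :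
    (1 - q) * (1 - q ^ 3) * qpoch (q ^ 5) (q ^ 2) n =
      qpoch q (q ^ 2) (n + 1) * (1 - q ^ (2 * n + 3)) := by
  have h1 : qpoch q (q ^ 2) (n + 2) = qpoch q (q ^ 2) (n + 1) * (1 - q ^ (2 * n + 3)) := by
    rw [qpoch, Finset.prod_range_succ, qpoch]
    ring
  rw [← h1, qpoch_q_q_sq, Finset.prod_range_succ', Finset.prod_range_succ', qpoch,
    Finset.prod_congr rfl fun i _ => show 1 - q ^ 5 * (q ^ 2) ^ i =
      1 - q ^ (2 * (i + 1 + 1) + 1) by ring]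
  ring

theorem prod_one_sub_q_pow_ne_zero (h : ℕ) (f : ℕ → ℕ) (hf : ∀ i, 0 < f i) :
    ∏ i ∈ range h, (1 - q ^ f i) ≠ 0 :=
  Finset.prod_ne_zero_iff.2 fun i _ => one_sub_q_pow_ne_zero (hf i)

theorem G_two_eq (h : ℕ) :
    G (2 * h + 1) 2 =
      -((1 + q ^ (2 * h + 4)) * q ^ 2 * (1 - q ^ (4 * h + 3)) ^ 2 *
          (∏ i ∈ range h, (1 - q ^ (2 * i + 1))) *
          (∏ i ∈ range h, (1 - q ^ (2 * h + 1 + (2 * i + 2)))) ^ 3) /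
        ((1 - q ^ 1) ^ 2 * q ^ ((2 * h + 1) * (h + 4)) *
          (∏ i ∈ range h, (1 - q ^ (2 * h + 1 + (2 * i + 1)))) *
          (∏ i ∈ range h, (1 - q ^ (2 * i + 2))) ^ 3) *
        (qint ((2 * h + 1 : ℕ) : ℤ) ^ 3 / (1 + q + q ^ 2) ^ 2) := by
  have h1 : 1 - q ≠ 0 := by simpa using one_sub_q_pow_ne_zero one_pos
  have h3 : 1 - q ^ 3 ≠ 0 := one_sub_q_pow_ne_zero (by norm_num)
  have hq := q_ne_zero
  have h5 : qpoch (q ^ 5) (q ^ 2) (2 * h) =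
      qpoch q (q ^ 2) (2 * h + 1) * (1 - q ^ (4 * h + 3)) / ((1 - q) * (1 - q ^ 3)) := by
    rw [eq_div_iff (mul_ne_zero h1 h3), mul_comm, qpoch_q_five]
    ring
  have hc : 1 + q + q ^ 2 = (1 - q ^ 3) / (1 - q) := by
    rw [eq_div_iff h1]; ring
  have he : q ^ (-(((2 * h + 1 : ℕ) : ℤ) * (((2 * h + 1 : ℕ) : ℤ) - 1) / 2) -
      (2 * ((2 * h + 1 : ℕ) : ℤ) - 1) * 2) = q ^ 2 / q ^ ((2 * h + 1) * (h + 4)) := by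
    rw [eq_div_iff (pow_ne_zero _ hq), ← zpow_natCast, ← zpow_natCast, ← zpow_add₀ hq]
    congr 1
    have : ((2 * h + 1 : ℕ) : ℤ) * (((2 * h + 1 : ℕ) : ℤ) - 1) / 2 = (2 * h + 1) * h := by
      apply Int.ediv_eq_of_eq_mul_left two_ne_zero
      push_cast; ring
    rw [this]
    push_cast; ring
  have hz : q ^ (((2 * h + 1 : ℕ) : ℤ) + 2 * 2 - 1) = q ^ (2 * h + 4) := by
    rw [← zpow_natCast]; congr 1; push_cast; ring
  have hz5 : q ^ (2 * 2 + 1 : ℤ) = q ^ 5 := by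
    rw [← zpow_natCast]; norm_num
  rw [G, if_neg (by omega), he, hz, hz5, Nat.add_sub_cancel, h5, qpoch_q_q_sq_split,
    qpoch_mul_prod_even, qpoch_q_sq_split, hc, qint, zpow_natCast]
  have ha := prod_one_sub_q_pow_ne_zero h (fun i => 2 * i + 1) (fun i => by omega)
  have hb := prod_one_sub_q_pow_ne_zero h (fun i => 2 * i + 2) (fun i => by omega)
  have ha' := prod_one_sub_q_pow_ne_zero h (fun i => 2 * h + 1 + (2 * i + 1)) (fun i => by omega)
  have hqk := pow_ne_zero ((2 * h + 1) * (h + 4)) hq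
  rw [pow_one]
  generalize (∏ i ∈ range h, (1 - q ^ (2 * i + 1))) = a at *
  generalize (∏ i ∈ range h, (1 - q ^ (2 * i + 2))) = b at *
  generalize (∏ i ∈ range h, (1 - q ^ (2 * h + 1 + (2 * i + 1)))) = a' at *
  generalize (∏ i ∈ range h, (1 - q ^ (2 * h + 1 + (2 * i + 2)))) = b' at *
  generalize q ^ ((2 * h + 1) * (h + 4)) = s at *
  generalize q ^ (4 * h + 3) = t at *
  generalize q ^ (2 * h + 4) = u at *
  generalize q ^ (2 * h + 1) = z at *
  generalize q ^ 3 = y at *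
  field_simp

/-- The numerator of the difference of the two cofactors of `[2h+1]^3/(1+q+q^2)^2`. -/
noncomputable def cofactorNum (h : ℕ) : ℚ[X] :=
  (1 + X ^ 3) * X ^ 2 * ((1 - X ^ 1) ^ 2 * X ^ ((2 * h + 1) * (h + 4)) *
      (∏ i ∈ range h, (1 - X ^ (2 * h + 1 + (2 * i + 1)))) *
      (∏ i ∈ range h, (1 - X ^ (2 * i + 2))) ^ 3) -
    (1 + X ^ (2 * h + 4)) * X ^ 2 * (1 - X ^ (4 * h + 3)) ^ 2 *
      (∏ i ∈ range h, (1 - X ^ (2 * i + 1))) *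
      (∏ i ∈ range h, (1 - X ^ (2 * h + 1 + (2 * i + 2)))) ^ 3

theorem cyclotomic_dvd_cofactorNum (h : ℕ) : cyclotomic (2 * h + 1) ℚ ∣ cofactorNum h := by
  rw [← AdjoinRoot.mk_eq_zero]
  set x := AdjoinRoot.mk (cyclotomic (2 * h + 1) ℚ) X with hx
  have hxm : x ^ (2 * h + 1) = 1 := by
    rw [hx, ← map_pow, ← sub_eq_zero, ← map_one (AdjoinRoot.mk _), ← map_sub,
      AdjoinRoot.mk_eq_zero]
    exact cyclotomic.dvd_X_pow_sub_one _ _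
  have h4 : x ^ (2 * h + 4) = x ^ 3 := by
    rw [show 2 * h + 4 = 2 * h + 1 + 3 by ring, pow_add, hxm, one_mul]
  have h43 : x ^ (4 * h + 3) = x := by
    rw [show 4 * h + 3 = (2 * h + 1) * 2 + 1 by ring, pow_succ, pow_mul, hxm, one_pow, one_mul]
  simp only [cofactorNum, map_sub, map_add, map_mul, map_pow, map_prod, map_one, ← hx, h4, h43,
    pow_mul, pow_add x (2 * h + 1), hxm, one_pow, one_mul, mul_one, pow_one]
  ring

/-- The common denominator of the two cofactors of `[2h+1]^3/(1+q+q^2)^2`. -/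
noncomputable def cofactorDenom (h : ℕ) : RatFunc ℚ :=
  (1 - q ^ 1) ^ 2 * q ^ ((2 * h + 1) * (h + 4)) *
    (∏ i ∈ range h, (1 - q ^ (2 * h + 1 + (2 * i + 1)))) *
    (∏ i ∈ range h, (1 - q ^ (2 * i + 2))) ^ 3

theorem cofactorDenom_ne_zero (h : ℕ) : cofactorDenom h ≠ 0 :=
  mul_ne_zero (mul_ne_zero (mul_ne_zero (pow_ne_zero _ (one_sub_q_pow_ne_zero one_pos))
    (pow_ne_zero _ q_ne_zero)) (prod_one_sub_q_pow_ne_zero h _ fun i => by omega))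
    (pow_ne_zero _ (prod_one_sub_q_pow_ne_zero h _ fun i => by omega))

theorem G_two_sub_eq (h : ℕ) :
    G (2 * h + 1) 2 - (-((1 + q ^ 3) * q ^ 2 / (1 + q + q ^ 2) ^ 2) *
        qint ((2 * h + 1 : ℕ) : ℤ) ^ 3) =
      algebraMap ℚ[X] (RatFunc ℚ) (cofactorNum h) / cofactorDenom h *
        (qint ((2 * h + 1 : ℕ) : ℤ) ^ 3 / (1 + q + q ^ 2) ^ 2) := by
  have hD := cofactorDenom_ne_zero h
  rw [G_two_eq, cofactorNum]
  simp only [map_sub, map_add, map_mul, map_pow, map_prod, map_one, algebraMap_X_eq_q]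
  rw [← cofactorDenom, sub_div, mul_div_cancel_right₀ _ hD]
  ring

section

variable {d h : ℕ} (hd : 0 < d)

theorem cyclotomicVal_prod_shift (hdh : d ∣ 2 * h + 1) (f : ℕ → ℕ) (hf : ∀ i, 0 < f i) :
    cyclotomicVal d hd (∏ i ∈ range h, (1 - q ^ (2 * h + 1 + f i))) =
      cyclotomicVal d hd (∏ i ∈ range h, (1 - q ^ f i)) := by
  rw [map_prod, map_prod]
  refine Finset.prod_congr rfl fun i _ => ?_
  rw [cyclotomicVal_one_sub_q_pow hd (hf i), cyclotomicVal_one_sub_q_pow hd (by omega)]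
  simp only [Nat.dvd_add_right hdh]

theorem cyclotomicVal_one_sub_q (hd1 : d ≠ 1) : cyclotomicVal d hd (1 - q ^ 1) = 1 := by
  rw [cyclotomicVal_one_sub_q_pow hd one_pos, if_neg (by simpa using hd1)]

theorem cyclotomicVal_qint (hd1 : d ≠ 1) (hdh : d ∣ 2 * h + 1) :
    cyclotomicVal d hd (qint ((2 * h + 1 : ℕ) : ℤ)) = exp (-1 : ℤ) := by
  have := cyclotomicVal_one_sub_q hd hd1
  rw [pow_one] at this
  rw [qint, map_div₀, this, zpow_natCast, div_one, cyclotomicVal_one_sub_q_pow hd (by omega),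
    if_pos hdh]

theorem cyclotomicVal_one_add_q_add_q_sq (hd1 : d ≠ 1) :
    cyclotomicVal d hd (1 + q + q ^ 2) = if d ∣ 3 then exp (-1 : ℤ) else 1 := by
  have := congrArg (cyclotomicVal d hd) one_add_q_add_q_sq_mul
  rwa [map_mul, cyclotomicVal_one_sub_q hd hd1, mul_one,
    cyclotomicVal_one_sub_q_pow hd three_pos] at this

theorem cyclotomicVal_cofactor_le_one (hd1 : d ≠ 1) (hdh : d ∣ 2 * h + 1) :
    cyclotomicVal d hd (algebraMap ℚ[X] (RatFunc ℚ) (cofactorNum h) / cofactorDenom h) ≤ 1 := by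
  have hpoly : ∀ p : ℚ[X], cyclotomicVal d hd (algebraMap ℚ[X] (RatFunc ℚ) p) ≤ 1 :=
    cyclotomicVal_algebraMap_le_one hd
  have hD := cofactorDenom_ne_zero h
  rw [cofactorNum]
  simp only [map_sub, map_add, map_mul, map_pow, map_prod, map_one, algebraMap_X_eq_q]
  rw [← cofactorDenom, sub_div, mul_div_cancel_right₀ _ hD]
  refine Valuation.map_sub_le (v := cyclotomicVal d hd) ?_ ?_
  · have hnum := hpoly ((1 + X ^ 3) * X ^ 2)
    simp only [map_add, map_mul, map_pow, map_one, algebraMap_X_eq_q] at hnum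
    simpa only [map_mul, map_pow] using hnum
  · have hnum := hpoly ((1 + X ^ (2 * h + 4)) * X ^ 2 * (1 - X ^ (4 * h + 3)) ^ 2)
    simp only [map_sub, map_add, map_mul, map_pow, map_one, algebraMap_X_eq_q] at hnum
    have hDv : cyclotomicVal d hd (cofactorDenom h) = cyclotomicVal d hd
        ((∏ i ∈ range h, (1 - q ^ (2 * i + 1))) *
          (∏ i ∈ range h, (1 - q ^ (2 * h + 1 + (2 * i + 2)))) ^ 3) := by
      rw [cofactorDenom]
      simp only [map_mul, map_pow]
      rw [cyclotomicVal_one_sub_q hd hd1, cyclotomicVal_q, one_pow, one_pow, one_mul, one_mul,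
        cyclotomicVal_prod_shift hd hdh (fun i => 2 * i + 1) fun i => by omega,
        cyclotomicVal_prod_shift hd hdh (fun i => 2 * i + 2) fun i => by omega]
    have hne := (Valuation.ne_zero_iff (cyclotomicVal d hd)).2 hD
    rw [map_div₀, mul_assoc _ (∏ i ∈ range h, (1 - q ^ (2 * i + 1))), map_mul, ← hDv,
      mul_div_cancel_right₀ _ hne]
    simpa only [map_mul, map_pow] using hnum

theorem cyclotomicVal_cofactor_le (hh : 0 < h) :
    cyclotomicVal (2 * h + 1) (Nat.succ_pos _)
      (algebraMap ℚ[X] (RatFunc ℚ) (cofactorNum h) / cofactorDenom h) ≤ exp (-1 : ℤ) := by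
  have hunit : ∀ r, 0 < r → ¬ 2 * h + 1 ∣ r →
      cyclotomicVal (2 * h + 1) (Nat.succ_pos _) (1 - q ^ r) = 1 := fun r hr hdr => by
    rw [cyclotomicVal_one_sub_q_pow _ hr, if_neg hdr]
  have hprod : ∀ f : ℕ → ℕ, (∀ i < h, 0 < f i ∧ f i < 2 * h + 1) →
      cyclotomicVal (2 * h + 1) (Nat.succ_pos _) (∏ i ∈ range h, (1 - q ^ f i)) = 1 := by
    intro f hf
    rw [map_prod]
    refine Finset.prod_eq_one fun i hi => ?_
    obtain ⟨h0, h1⟩ := hf i (Finset.mem_range.1 hi)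
    exact hunit _ h0 (Nat.not_dvd_of_pos_of_lt h0 h1)
  have hD : cyclotomicVal (2 * h + 1) (Nat.succ_pos _) (cofactorDenom h) = 1 := by
    rw [cofactorDenom]
    simp only [map_mul, map_pow]
    rw [cyclotomicVal_one_sub_q _ (by omega), cyclotomicVal_q,
      cyclotomicVal_prod_shift _ dvd_rfl (fun i => 2 * i + 1) fun i => by omega,
      hprod (fun i => 2 * i + 1) fun i hi => by omega,
      hprod (fun i => 2 * i + 2) fun i hi => by omega]
    simp
  rw [map_div₀, hD, div_one]
  have := (cyclotomicVal_algebraMap_le_iff (d := 2 * h + 1) (Nat.succ_pos _) (cofactorNum h) 1).2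
    (by simpa using cyclotomic_dvd_cofactorNum h)
  simpa using this

end

theorem cyclotomic_dvd_num_G_two_sub {d h : ℕ} (hd1 : d ≠ 1) (hdh : d ∣ 2 * h + 1) :
    cyclotomic d ℚ ∣ (G (2 * h + 1) 2 - (-((1 + q ^ 3) * q ^ 2 / (1 + q + q ^ 2) ^ 2) *
        qint ((2 * h + 1 : ℕ) : ℤ) ^ 3)).num := by
  have hd : 0 < d := Nat.pos_of_dvd_of_pos hdh (by omega)
  rw [← pow_one (cyclotomic d ℚ)]
  apply cyclotomic_pow_dvd_num hd
  rw [G_two_sub_eq, map_mul]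
  refine (mul_le_of_le_one_left' (cyclotomicVal_cofactor_le_one hd hd1 hdh)).trans ?_
  rw [map_div₀, map_pow, map_pow, cyclotomicVal_qint hd hd1 hdh,
    cyclotomicVal_one_add_q_add_q_sq hd hd1]
  split_ifs
  · rw [← exp_nsmul, ← exp_nsmul, ← exp_sub, exp_le_exp]
    norm_num
  · rw [one_pow, div_one, ← exp_nsmul, exp_le_exp]
    norm_num

theorem cyclotomic_pow_four_dvd_num_G_two_sub {h : ℕ} (hh : 1 < h) :
    cyclotomic (2 * h + 1) ℚ ^ 4 ∣
      (G (2 * h + 1) 2 - (-((1 + q ^ 3) * q ^ 2 / (1 + q + q ^ 2) ^ 2) *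
        qint ((2 * h + 1 : ℕ) : ℤ) ^ 3)).num := by
  apply cyclotomic_pow_dvd_num (Nat.succ_pos _)
  rw [G_two_sub_eq, map_mul]
  refine (mul_le_mul_left (cyclotomicVal_cofactor_le (by omega)) _).trans ?_
  rw [map_div₀, map_pow, map_pow, cyclotomicVal_qint _ (by omega) dvd_rfl,
    cyclotomicVal_one_add_q_add_q_sq _ (by omega),
    if_neg (Nat.not_dvd_of_pos_of_lt three_pos (by omega)), one_pow, div_one, ← exp_nsmul,
    ← exp_add, exp_le_exp]
  norm_num

theorem stmt_16 (m : ℕ) (hm : 3 < m) (hodd : Odd m) :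
    ratCongr (G m 2) (-((1 + q ^ 3) * q ^ 2 / (1 + q + q ^ 2) ^ 2) * (qint m) ^ 3)
      (qintPoly m * (Polynomial.cyclotomic m ℚ) ^ 3) := by
  obtain ⟨h, rfl⟩ := hodd
  have hmem : 2 * h + 1 ∈ (2 * h + 1).divisors.erase 1 := by
    simp only [Finset.mem_erase, Nat.mem_divisors]
    exact ⟨by omega, dvd_rfl, by omega⟩
  rw [ratCongr, qintPoly, ← prod_cyclotomic_eq_geom_sum (by omega),
    ← Finset.mul_prod_erase _ _ hmem, mul_right_comm, ← pow_succ']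
  refine IsCoprime.mul_dvd ?_ (cyclotomic_pow_four_dvd_num_G_two_sub (by omega)) ?_
  · refine IsCoprime.pow_left (IsCoprime.prod_right fun i hi => ?_)
    exact cyclotomic.isCoprime_rat (Finset.ne_of_mem_erase hi).symm
  · refine Finset.prod_dvd_of_coprime (fun i _ j _ hij => cyclotomic.isCoprime_rat hij)
      fun i hi => ?_
    have hi' := Finset.mem_of_mem_erase hi
    exact cyclotomic_dvd_num_G_two_sub (Finset.ne_of_mem_erase hi')
      (Nat.dvd_of_mem_divisors (Finset.mem_of_mem_erase hi'))
end

section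
/- Let m > 3 be an odd integer and let G be defined as below. Then, modulo [m]·Φ_m(q)^3, the following q-congruence of rational functions holds: G(m,-1) ≡ -((1+q^3)·q^2/(1+q+q^2)^2)·[m]^3. -/
open Finset Polynomial

open IsDedekindDomain

section Products

variable {M : Type*} [CommMonoid M]

theorem prod_range_odd_mul_even (f : ℕ → M) (t : ℕ) :
    (∏ i ∈ range t, f (2 * i + 1)) * ∏ i ∈ range t, f (2 * i + 2) =
      ∏ i ∈ range (2 * t), f (i + 1) := by
  induction t with
  | zero => simp
  | succ t ih =>
    rw [prod_range_succ, prod_range_succ, mul_mul_mul_comm, ih, mul_add_one,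
      prod_range_succ, prod_range_succ, mul_assoc]

theorem prod_range_odd_split (f : ℕ → M) (a b : ℕ) :
    ∏ i ∈ range (a + 1 + b), f (2 * i + 1) =
      f (2 * a + 1) * ((∏ i ∈ range a, f (2 * i + 1)) *
        ∏ i ∈ range b, f (2 * i + 2 + (2 * a + 1))) := by
  rw [prod_range_add, prod_range_succ, mul_comm _ (f (2 * a + 1)), mul_assoc]
  congr 2
  exact prod_congr rfl fun i _ => congrArg f (by ring)

theorem prod_range_odd_eq_of_periodic (f : ℕ → M) (t : ℕ)
    (hf : f.Periodic (2 * t + 1)) :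
    (∏ i ∈ range t, f (2 * i + 1)) * ∏ i ∈ range t, f (2 * i + 2 + (2 * t + 1)) =
      ∏ i ∈ range (2 * t), f (i + 1) := by
  simp only [hf _, prod_range_odd_mul_even]

theorem prod_range_even_eq_of_periodic (f : ℕ → M) (t : ℕ)
    (hf : f.Periodic (2 * t + 1)) :
    ∏ i ∈ range (2 * t), f (2 * i + 2) = ∏ i ∈ range (2 * t), f (i + 1) := by
  rw [two_mul t, prod_range_add, ← two_mul, ← prod_range_odd_mul_even, mul_comm]
  congr 1
  refine prod_congr rfl fun i _ => ?_
  rw [← hf (2 * i + 1)]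
  exact congrArg f (by ring)

/-- The product of `f j` over odd `j` in `[1, 4s + 9]`, with the middle index `2s + 5` left out. -/
def oddProd (f : ℕ → M) (s : ℕ) : M :=
  (∏ i ∈ range (s + 2), f (2 * i + 1)) *
    ∏ i ∈ range (s + 2), f (2 * i + 2 + (2 * (s + 2) + 1))

/-- The product of `f j` over odd `j` in `[1, 4s + 5]`, with the index `2s + 5` left out. -/
def shortOddProd (f : ℕ → M) (s : ℕ) : M :=
  (∏ i ∈ range (s + 2), f (2 * i + 1)) *
    ∏ i ∈ range s, f (2 * i + 2 + (2 * (s + 2) + 1))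

theorem oddProd_eq_shortOddProd_mul (f : ℕ → M) (s : ℕ) :
    oddProd f s = shortOddProd f s * (f (4 * s + 7) * f (4 * s + 9)) := by
  simp only [oddProd, shortOddProd, prod_range_succ _ (s + 1), prod_range_succ _ s, mul_assoc]
  rw [show 2 * s + 2 + (2 * (s + 2) + 1) = 4 * s + 7 by ring,
    show 2 * (s + 1) + 2 + (2 * (s + 2) + 1) = 4 * s + 9 by ring]

theorem oddProd_eq_of_periodic (f : ℕ → M) {s : ℕ} (hf : f.Periodic (2 * (s + 2) + 1)) :
    oddProd f s = ∏ i ∈ range (2 * (s + 2)), f (i + 1) :=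
  prod_range_odd_eq_of_periodic f (s + 2) hf

theorem map_oddProd {N F : Type*} [CommMonoid N] [FunLike F M N] [MonoidHomClass F M N]
    (φ : F) (f : ℕ → M) (s : ℕ) : φ (oddProd f s) = oddProd (fun n => φ (f n)) s := by
  simp [oddProd]

theorem map_shortOddProd {N F : Type*} [CommMonoid N] [FunLike F M N] [MonoidHomClass F M N]
    (φ : F) (f : ℕ → M) (s : ℕ) : φ (shortOddProd f s) = shortOddProd (fun n => φ (f n)) s := by
  simp [shortOddProd]

end Products

section Place

/-- The place of `ℚ(q)` attached to a prime polynomial. -/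
noncomputable def primePlace {p : ℚ[X]} (hp : Prime p) : HeightOneSpectrum ℚ[X] where
  asIdeal := Ideal.span {p}
  isPrime := (Ideal.span_singleton_prime hp.ne_zero).2 hp
  ne_bot := by simpa using hp.ne_zero

/-- The valuation of `ℚ(q)` attached to a prime polynomial. -/
noncomputable def primeVal {p : ℚ[X]} (hp : Prime p) :
    Valuation (RatFunc ℚ) (WithZero (Multiplicative ℤ)) :=
  (primePlace hp).valuation (RatFunc ℚ)

variable {p : ℚ[X]} (hp : Prime p)

theorem primeVal_self :
    primeVal hp (algebraMap ℚ[X] (RatFunc ℚ) p) = WithZero.exp (-1 : ℤ) := by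
  rw [primeVal, HeightOneSpectrum.valuation_of_algebraMap]
  exact HeightOneSpectrum.intValuation_singleton _ hp.ne_zero rfl

theorem primeVal_le_one (a : ℚ[X]) : primeVal hp (algebraMap ℚ[X] (RatFunc ℚ) a) ≤ 1 :=
  (primePlace hp).valuation_le_one a

theorem primeVal_eq_one_iff {a : ℚ[X]} :
    primeVal hp (algebraMap ℚ[X] (RatFunc ℚ) a) = 1 ↔ ¬ p ∣ a := by
  rw [primeVal, HeightOneSpectrum.valuation_of_algebraMap,
    HeightOneSpectrum.intValuation_eq_one_iff]
  exact not_congr Ideal.mem_span_singleton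

theorem pow_dvd_num_of_primeVal_le {x : RatFunc ℚ} {n : ℕ}
    (h : primeVal hp x ≤ WithZero.exp (-1 : ℤ) ^ n) : p ^ n ∣ x.num := by
  have hx : algebraMap ℚ[X] (RatFunc ℚ) x.num = x * algebraMap ℚ[X] (RatFunc ℚ) x.denom := by
    exact (div_eq_iff (RatFunc.algebraMap_ne_zero x.denom_ne_zero)).1 x.num_div_denom
  have h2 : primeVal hp (algebraMap ℚ[X] (RatFunc ℚ) x.num) ≤ WithZero.exp (-1 : ℤ) ^ n := by
    rw [hx, map_mul]
    exact (mul_le_of_le_one_right' (primeVal_le_one hp _)).trans h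
  rw [primeVal, HeightOneSpectrum.valuation_of_algebraMap, ← WithZero.exp_nsmul,
    show n • (-1 : ℤ) = -(n : ℤ) by simp, HeightOneSpectrum.intValuation_le_pow_iff_mem] at h2
  simpa [primePlace, Ideal.span_singleton_pow, Ideal.mem_span_singleton] using h2

theorem primeVal_le_of_dvd {a : ℚ[X]} (h : p ∣ a) :
    primeVal hp (algebraMap ℚ[X] (RatFunc ℚ) a) ≤ WithZero.exp (-1 : ℤ) := by
  obtain ⟨b, rfl⟩ := h
  rw [map_mul, map_mul, primeVal_self]
  exact mul_le_of_le_one_right' (primeVal_le_one hp b)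

theorem primeVal_eq_of_squarefree {a : ℚ[X]} (ha : Squarefree a) (h : p ∣ a) :
    primeVal hp (algebraMap ℚ[X] (RatFunc ℚ) a) = WithZero.exp (-1 : ℤ) := by
  obtain ⟨b, rfl⟩ := h
  rw [map_mul, map_mul, primeVal_self, (primeVal_eq_one_iff hp).2, mul_one]
  exact fun hb => hp.not_isUnit (ha p (mul_dvd_mul_left p hb))

end Place

theorem algebraMap_one_sub_X_pow (e : ℕ) :
    algebraMap ℚ[X] (RatFunc ℚ) (1 - X ^ e) = 1 - q ^ e := by
  simp [q]

theorem cyclotomic_dvd_one_sub_X_pow_iff {d e : ℕ} (hd : 0 < d) :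
    cyclotomic d ℚ ∣ 1 - X ^ e ↔ d ∣ e := by
  have hζ := Complex.isPrimitiveRoot_exp d hd.ne'
  rw [cyclotomic_eq_minpoly_rat hζ hd, minpoly.dvd_iff, ← hζ.pow_eq_one_iff_dvd e,
    map_sub, map_one, map_pow, aeval_X, sub_eq_zero, eq_comm]

theorem cyclotomic_prime_rat {d : ℕ} (hd : 0 < d) : Prime (cyclotomic d ℚ) :=
  (cyclotomic.irreducible_rat hd).prime

section CyclotomicVal

variable {d : ℕ} (hd : 0 < d)

theorem primeVal_cyclotomic_one_sub_q_pow {e : ℕ} (he : e ≠ 0) :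
    primeVal (cyclotomic_prime_rat hd) (1 - q ^ e) =
      if d ∣ e then WithZero.exp (-1 : ℤ) else 1 := by
  rw [← algebraMap_one_sub_X_pow]
  split_ifs with h
  · refine primeVal_eq_of_squarefree _ ?_ ((cyclotomic_dvd_one_sub_X_pow_iff hd).2 h)
    have := (X_pow_sub_one_separable_iff (F := ℚ).2 (Nat.cast_ne_zero.2 he)).squarefree
    exact (Associated.squarefree_iff ⟨-1, by simp⟩).1 this
  · exact (primeVal_eq_one_iff _).2 (mt (cyclotomic_dvd_one_sub_X_pow_iff hd).1 h)

theorem primeVal_cyclotomic_q : primeVal (cyclotomic_prime_rat hd) q = 1 := by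
  refine (primeVal_eq_one_iff (a := X) _).2 fun h => (cyclotomic_prime_rat hd).not_isUnit ?_
  rw [isUnit_iff_dvd_one]
  simpa using dvd_add ((cyclotomic_dvd_one_sub_X_pow_iff hd).2 dvd_rfl) (h.pow hd.ne')

end CyclotomicVal

theorem G_neg_one_eq (s : ℕ) :
    G (2 * s + 5) (-1) =
      -((1 + q ^ (2 * s + 2)) * ((1 - q ^ (2 * s + 5)) * oddProd (fun n => 1 - q ^ n) s) *
        ((1 - q) * ((1 - q ^ (2 * s + 5)) * shortOddProd (fun n => 1 - q ^ n) s)) ^ 2 *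
        q ^ (4 * s + 7)) /
      (q ^ ((2 * s + 5) * (s + 2)) * (1 - q) *
        (∏ i ∈ range (2 * (s + 2)), (1 - q ^ (i + 1))) ^ 2 *
        ∏ i ∈ range (2 * (s + 2)), (1 - q ^ (2 * i + 2))) := by
  have hq : q ≠ 0 := RatFunc.X_ne_zero
  have hA : qpoch q (q ^ 2) (2 * s + 5) =
      (1 - q ^ (2 * s + 5)) * oddProd (fun n => 1 - q ^ n) s := by
    have h := prod_range_odd_split (fun n => 1 - q ^ n) (s + 2) (s + 2)
    rw [show s + 2 + 1 + (s + 2) = 2 * s + 5 by ring] at h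
    rw [oddProd, show 2 * s + 5 = 2 * (s + 2) + 1 by ring, ← h, qpoch]
    exact prod_congr (by congr 1) fun i _ => by ring
  have hB : qpoch (q ^ (2 * (-1 : ℤ) + 1)) (q ^ 2) (2 * s + 5 - 1) =
      -q⁻¹ * ((1 - q) * ((1 - q ^ (2 * s + 5)) * shortOddProd (fun n => 1 - q ^ n) s)) := by
    have h := prod_range_odd_split (fun n => 1 - q ^ n) (s + 2) s
    rw [show s + 2 + 1 + s = 2 * s + 3 by ring] at h
    rw [shortOddProd, show 2 * s + 5 = 2 * (s + 2) + 1 by ring, ← h, qpoch,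
      show 2 * (s + 2) + 1 - 1 = 2 * s + 3 + 1 by omega, prod_range_succ',
      show (2 * (-1 : ℤ) + 1) = -1 by norm_num, zpow_neg_one]
    have : ∏ i ∈ range (2 * s + 3), (1 - q⁻¹ * (q ^ 2) ^ (i + 1)) =
        ∏ i ∈ range (2 * s + 3), (1 - q ^ (2 * i + 1)) :=
      prod_congr rfl fun i _ => by field_simp; ring
    rw [this]
    field_simp
    ring
  have hC : qpoch q q (2 * s + 5 - 1) = ∏ i ∈ range (2 * (s + 2)), (1 - q ^ (i + 1)) :=
    prod_congr (by congr 1) fun i _ => by ring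
  have hE : qpoch (q ^ 2) (q ^ 2) (2 * s + 5 - 1) =
      ∏ i ∈ range (2 * (s + 2)), (1 - q ^ (2 * i + 2)) :=
    prod_congr (by congr 1) fun i _ => by ring
  have he : -(((2 * s + 5 : ℕ) : ℤ) * (((2 * s + 5 : ℕ) : ℤ) - 1) / 2) -
      (2 * ((2 * s + 5 : ℕ) : ℤ) - 1) * (-1) =
      ((4 * s + 7 : ℕ) : ℤ) + (2 : ℕ) - ((2 * s + 5) * (s + 2) : ℕ) := by
    have : ((2 * s + 5 : ℕ) : ℤ) * (((2 * s + 5 : ℕ) : ℤ) - 1) =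
        2 * ((2 * s + 5) * (s + 2)) := by
      push_cast; ring
    rw [this, Int.mul_ediv_cancel_left _ two_ne_zero]
    push_cast
    ring
  have h1 : ((2 * s + 5 : ℕ) : ℤ) + 2 * (-1) - 1 = (2 * s + 2 : ℕ) := by push_cast; ring
  rw [G, if_neg (by omega), hA, hB, hC, hE, he, h1, zpow_sub₀ hq, zpow_add₀ hq]
  simp only [zpow_natCast, div_eq_mul_inv, mul_inv]
  field_simp

theorem root_identity {K : Type*} [Field K] {z : K} {s : ℕ} (hz : z ^ (2 * s + 5) = 1) :
    (1 + z ^ (2 * s + 2)) * oddProd (fun n => 1 - z ^ n) s *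
        shortOddProd (fun n => 1 - z ^ n) s ^ 2 * (1 - z) ^ 4 * z ^ (4 * s + 7) *
        (1 + z + z ^ 2) ^ 2 =
      (1 + z ^ 3) * z ^ 2 * z ^ ((2 * s + 5) * (s + 2)) *
        (∏ i ∈ range (2 * (s + 2)), (1 - z ^ (i + 1))) ^ 2 *
        ∏ i ∈ range (2 * (s + 2)), (1 - z ^ (2 * i + 2)) := by
  have hz0 : z ≠ 0 := by
    rintro rfl
    simp at hz
  have hper : (fun n => 1 - z ^ n).Periodic (2 * (s + 2) + 1) := fun n => by
    simp only [pow_add _ n, show 2 * (s + 2) + 1 = 2 * s + 5 by ring, hz, mul_one]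
  rw [prod_range_even_eq_of_periodic (fun n => 1 - z ^ n) _ hper,
    ← oddProd_eq_of_periodic (fun n => 1 - z ^ n) hper, oddProd_eq_shortOddProd_mul, pow_mul, hz,
    one_pow,
    show z ^ (2 * s + 2) = (z ^ 3)⁻¹ from eq_inv_of_mul_eq_one_left (by rw [← pow_add, ← hz]),
    show z ^ (4 * s + 7) = (z ^ 3)⁻¹ from eq_inv_of_mul_eq_one_left (by
      rw [← pow_add, show 4 * s + 7 + 3 = (2 * s + 5) * 2 by ring, pow_mul, hz, one_pow]),
    show z ^ (4 * s + 9) = z⁻¹ from eq_inv_of_mul_eq_one_left (by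
      rw [← pow_succ, show 4 * s + 9 + 1 = (2 * s + 5) * 2 by ring, pow_mul, hz, one_pow])]
  field_simp
  ring

section CyclotomicValDvd

variable {d s : ℕ} (hd : 0 < d)

theorem primeVal_cyclotomic_one_add_q_pow_le (k : ℕ) :
    primeVal (cyclotomic_prime_rat hd) (1 + q ^ k) ≤ 1 := by
  rw [show 1 + q ^ k = algebraMap ℚ[X] (RatFunc ℚ) (1 + X ^ k) by simp [q]]
  exact primeVal_le_one _ _

theorem primeVal_cyclotomic_one_sub_q (h1 : d ≠ 1) :
    primeVal (cyclotomic_prime_rat hd) (1 - q) = 1 := by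
  simpa [h1] using primeVal_cyclotomic_one_sub_q_pow hd one_ne_zero

theorem primeVal_cyclotomic_one_add_q_add_q_sq (h1 : d ≠ 1) :
    primeVal (cyclotomic_prime_rat hd) (1 + q + q ^ 2) =
      primeVal (cyclotomic_prime_rat hd) (1 - q ^ 3) := by
  rw [show 1 - q ^ 3 = (1 - q) * (1 + q + q ^ 2) by ring, map_mul,
    primeVal_cyclotomic_one_sub_q hd h1, one_mul]

theorem le_primeVal_cyclotomic_one_sub_q_pow {e : ℕ} (he : e ≠ 0) :
    WithZero.exp (-1 : ℤ) ≤ primeVal (cyclotomic_prime_rat hd) (1 - q ^ e) := by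
  rw [primeVal_cyclotomic_one_sub_q_pow hd he]
  split_ifs
  · exact le_rfl
  · rw [← WithZero.exp_zero, WithZero.exp_le_exp]
    norm_num

theorem primeVal_cyclotomic_one_sub_q_pow_ne_zero {e : ℕ} (he : e ≠ 0) :
    primeVal (cyclotomic_prime_rat hd) (1 - q ^ e) ≠ 0 :=
  (WithZero.exp_pos.trans_le (le_primeVal_cyclotomic_one_sub_q_pow hd he)).ne'

theorem primeVal_cyclotomic_prod_ne_zero (n : ℕ) :
    primeVal (cyclotomic_prime_rat hd) (∏ i ∈ range n, (1 - q ^ (i + 1))) ≠ 0 := by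
  rw [map_prod]
  exact prod_ne_zero_iff.2 fun i _ =>
    primeVal_cyclotomic_one_sub_q_pow_ne_zero hd i.succ_ne_zero

theorem periodic_ite_dvd {α : Type*} (a b : α) {n : ℕ} (h : d ∣ n) :
    (fun e => if d ∣ e then a else b).Periodic n := fun e => by
  simp [Nat.dvd_add_left h]

theorem primeVal_cyclotomic_prod_even (hds : d ∣ 2 * s + 5) :
    primeVal (cyclotomic_prime_rat hd) (∏ i ∈ range (2 * (s + 2)), (1 - q ^ (2 * i + 2))) =
      primeVal (cyclotomic_prime_rat hd) (∏ i ∈ range (2 * (s + 2)), (1 - q ^ (i + 1))) := by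
  simp only [map_prod, primeVal_cyclotomic_one_sub_q_pow hd (Nat.succ_ne_zero _)]
  exact prod_range_even_eq_of_periodic _ _ (periodic_ite_dvd _ _ hds)

theorem primeVal_cyclotomic_oddProd (hds : d ∣ 2 * s + 5) :
    primeVal (cyclotomic_prime_rat hd) (oddProd (fun n => 1 - q ^ n) s) =
      primeVal (cyclotomic_prime_rat hd) (∏ i ∈ range (2 * (s + 2)), (1 - q ^ (i + 1))) := by
  rw [map_oddProd, map_prod, oddProd]
  simp only [← add_assoc, primeVal_cyclotomic_one_sub_q_pow hd (Nat.succ_ne_zero _)]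
  exact prod_range_odd_eq_of_periodic _ _ (periodic_ite_dvd _ _ hds)

theorem exp_mul_primeVal_cyclotomic_shortOddProd_le (hds : d ∣ 2 * s + 5) (h1 : d ≠ 1) :
    WithZero.exp (-1 : ℤ) * primeVal (cyclotomic_prime_rat hd)
      (shortOddProd (fun n => 1 - q ^ n) s) ≤
      primeVal (cyclotomic_prime_rat hd) (∏ i ∈ range (2 * (s + 2)), (1 - q ^ (i + 1))) := by
  have h9 : ¬ d ∣ 4 * s + 9 := fun h => h1 <| Nat.dvd_one.1 <| by
    have := Nat.dvd_sub (hds.mul_left 2) h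
    rwa [show 2 * (2 * s + 5) - (4 * s + 9) = 1 by omega] at this
  rw [← primeVal_cyclotomic_oddProd hd hds, oddProd_eq_shortOddProd_mul, map_mul, map_mul,
    primeVal_cyclotomic_one_sub_q_pow hd (e := 4 * s + 9) (by omega), if_neg h9, mul_one, mul_comm]
  gcongr
  exact le_primeVal_cyclotomic_one_sub_q_pow hd (by omega)

theorem primeVal_cyclotomic_G_le (hds : d ∣ 2 * s + 5) (h1 : d ≠ 1) :
    primeVal (cyclotomic_prime_rat hd) (G (2 * s + 5) (-1)) ≤ WithZero.exp (-1 : ℤ) := by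
  have hb := exp_mul_primeVal_cyclotomic_shortOddProd_le hd hds h1
  have hc := primeVal_cyclotomic_prod_ne_zero hd (2 * (s + 2))
  rw [G_neg_one_eq]
  simp only [map_div₀, map_mul, map_pow, Valuation.map_neg, primeVal_cyclotomic_q hd,
    primeVal_cyclotomic_one_sub_q hd h1, primeVal_cyclotomic_prod_even hd hds,
    primeVal_cyclotomic_oddProd hd hds, one_pow, one_mul, mul_one,
    primeVal_cyclotomic_one_sub_q_pow hd (e := 2 * s + 5) (by omega), if_pos hds]
  generalize primeVal (cyclotomic_prime_rat hd)
    (∏ i ∈ range (2 * (s + 2)), (1 - q ^ (i + 1))) = c at *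
  generalize primeVal (cyclotomic_prime_rat hd) (shortOddProd (fun n => 1 - q ^ n) s) = b at *
  rw [div_le_iff₀ (zero_lt_iff.2 (by simp [hc]))]
  calc _ ≤ 1 * (WithZero.exp (-1 : ℤ) * c) * c ^ 2 := by
        gcongr
        exact primeVal_cyclotomic_one_add_q_pow_le hd _
    _ = _ := by rw [one_mul, mul_assoc, mul_comm c]

theorem primeVal_cyclotomic_qint_pow_le (hds : d ∣ 2 * s + 5) (h1 : d ≠ 1) :
    primeVal (cyclotomic_prime_rat hd)
      (-((1 + q ^ 3) * q ^ 2 / (1 + q + q ^ 2) ^ 2) * (qint (2 * s + 5 : ℕ)) ^ 3) ≤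
      WithZero.exp (-1 : ℤ) := by
  have h3 := le_primeVal_cyclotomic_one_sub_q_pow hd three_ne_zero
  have h30 := primeVal_cyclotomic_one_sub_q_pow_ne_zero hd three_ne_zero
  rw [qint, zpow_natCast]
  simp only [map_div₀, map_mul, map_pow, Valuation.map_neg, primeVal_cyclotomic_q hd,
    primeVal_cyclotomic_one_sub_q hd h1, primeVal_cyclotomic_one_add_q_add_q_sq hd h1,
    primeVal_cyclotomic_one_sub_q_pow hd (e := 2 * s + 5) (by omega), if_pos hds,
    one_pow, mul_one, div_one]
  generalize primeVal (cyclotomic_prime_rat hd) (1 - q ^ 3) = c at *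
  rw [div_mul_eq_mul_div, div_le_iff₀ (zero_lt_iff.2 (by simp [h30]))]
  calc _ ≤ 1 * (WithZero.exp (-1 : ℤ) * WithZero.exp (-1 : ℤ) ^ 2) := by
        rw [← pow_succ']
        gcongr
        exact primeVal_cyclotomic_one_add_q_pow_le hd 3
    _ ≤ _ := by
        rw [one_mul]
        gcongr

end CyclotomicValDvd

theorem cyclotomic_dvd_numerator (s : ℕ) :
    cyclotomic (2 * s + 5) ℚ ∣
      (1 + X ^ (2 * s + 2)) * oddProd (fun n => 1 - X ^ n) s *
        shortOddProd (fun n => 1 - X ^ n) s ^ 2 * (1 - X) ^ 4 * X ^ (4 * s + 7) *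
        (1 + X + X ^ 2) ^ 2 -
      (1 + X ^ 3) * X ^ 2 * X ^ ((2 * s + 5) * (s + 2)) *
        (∏ i ∈ range (2 * (s + 2)), (1 - X ^ (i + 1))) ^ 2 *
        ∏ i ∈ range (2 * (s + 2)), (1 - X ^ (2 * i + 2)) := by
  have hm : 0 < 2 * s + 5 := by omega
  have hζ := Complex.isPrimitiveRoot_exp (2 * s + 5) hm.ne'
  rw [cyclotomic_eq_minpoly_rat hζ hm, minpoly.dvd_iff, map_sub, sub_eq_zero]
  simpa [map_oddProd, map_shortOddProd] using root_identity hζ.pow_eq_one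

theorem sub_eq_pow_mul_div {K : Type*} [Field K] {z x y a b c e u w : K} (h1 : 1 - z ≠ 0)
    (h3 : 1 + z + z ^ 2 ≠ 0) (hc : c ≠ 0) (he : e ≠ 0) (hw : w ≠ 0) :
    -((1 + x) * (y * a) * ((1 - z) * (y * b)) ^ 2 * u) / (w * (1 - z) * c ^ 2 * e) -
        -((1 + z ^ 3) * z ^ 2 / (1 + z + z ^ 2) ^ 2) * (y / (1 - z)) ^ 3 =
      (y / (1 - z)) ^ 3 *
        -(((1 + x) * a * b ^ 2 * (1 - z) ^ 4 * u * (1 + z + z ^ 2) ^ 2 -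
          (1 + z ^ 3) * z ^ 2 * w * c ^ 2 * e) / (w * c ^ 2 * e * (1 + z + z ^ 2) ^ 2)) := by
  field_simp
  ring

theorem primeVal_cyclotomic_G_sub_le (s : ℕ) :
    primeVal (cyclotomic_prime_rat (d := 2 * s + 5) (Nat.succ_pos _))
      (G (2 * s + 5) (-1) -
        -((1 + q ^ 3) * q ^ 2 / (1 + q + q ^ 2) ^ 2) * (qint (2 * s + 5 : ℕ)) ^ 3) ≤
      WithZero.exp (-1 : ℤ) ^ 4 := by
  have hd : 0 < 2 * s + 5 := by omega
  have h1 : 2 * s + 5 ≠ 1 := by omega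
  have h3 : primeVal (cyclotomic_prime_rat hd) (1 + q + q ^ 2) = 1 := by
    rw [primeVal_cyclotomic_one_add_q_add_q_sq hd h1,
      primeVal_cyclotomic_one_sub_q_pow hd three_ne_zero,
      if_neg (Nat.not_dvd_of_pos_of_lt three_pos (by omega))]
  have hc : primeVal (cyclotomic_prime_rat hd)
      (∏ i ∈ range (2 * (s + 2)), (1 - q ^ (i + 1))) = 1 := by
    rw [map_prod]
    refine prod_eq_one fun i hi => ?_
    rw [primeVal_cyclotomic_one_sub_q_pow hd i.succ_ne_zero,
      if_neg (Nat.not_dvd_of_pos_of_lt i.succ_pos (by rw [mem_range] at hi; omega))]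
  have hE := (primeVal_cyclotomic_prod_even hd dvd_rfl).trans hc
  have hN := primeVal_le_of_dvd (cyclotomic_prime_rat hd) (cyclotomic_dvd_numerator s)
  have hq1 := primeVal_cyclotomic_one_sub_q hd h1
  have hq := primeVal_cyclotomic_q hd
  have hm : primeVal (cyclotomic_prime_rat hd) (1 - q ^ (2 * s + 5)) = WithZero.exp (-1 : ℤ) := by
    rw [primeVal_cyclotomic_one_sub_q_pow hd (by omega), if_pos dvd_rfl]
  have ne_zero {x : RatFunc ℚ} (hx : primeVal (cyclotomic_prime_rat hd) x = 1) : x ≠ 0 := by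
    rintro rfl
    simp at hx
  simp only [map_sub, map_mul, map_add, map_pow, map_one, map_prod, map_oddProd, map_shortOddProd,
    show algebraMap ℚ[X] (RatFunc ℚ) X = q from rfl] at hN
  rw [G_neg_one_eq, qint, zpow_natCast,
    sub_eq_pow_mul_div (ne_zero hq1) (ne_zero h3) (ne_zero hc) (ne_zero hE)
      (pow_ne_zero _ (ne_zero hq)), map_mul, Valuation.map_neg, map_div₀ _ (_ - _)]
  simp only [map_pow, map_div₀, map_mul, hm, hq1, h3, hc, hE, hq, one_pow, one_mul, div_one]
  rw [pow_succ]
  exact mul_le_mul_right hN _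

theorem stmt_17 (m : ℕ) (hm : 3 < m) (hodd : Odd m) :
    ratCongr (G m (-1)) (-((1 + q ^ 3) * q ^ 2 / (1 + q + q ^ 2) ^ 2) * (qint m) ^ 3)
      (qintPoly m * (Polynomial.cyclotomic m ℚ) ^ 3) := by
  obtain ⟨s, rfl⟩ : ∃ s, m = 2 * s + 5 := by
    obtain ⟨k, rfl⟩ := hodd
    exact ⟨k - 2, by omega⟩
  have hmem : 2 * s + 5 ∈ (2 * s + 5).divisors.erase 1 := by simp
  rw [ratCongr, qintPoly, ← prod_cyclotomic_eq_geom_sum (by omega), ← mul_prod_erase _ _ hmem,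
    mul_right_comm, ← pow_succ']
  refine IsCoprime.mul_dvd ?_ ?_ ?_
  · exact IsCoprime.pow_left <| IsCoprime.prod_right fun d hd =>
      cyclotomic.isCoprime_rat (ne_of_mem_erase hd).symm
  · exact pow_dvd_num_of_primeVal_le _ (primeVal_cyclotomic_G_sub_le s)
  · refine prod_dvd_of_coprime (fun a _ b _ hab => cyclotomic.isCoprime_rat hab) fun d hd => ?_
    obtain ⟨-, h1, hdvd⟩ : _ ∧ d ≠ 1 ∧ d ∣ 2 * s + 5 := by simpa using hd
    have hd0 := Nat.pos_of_dvd_of_pos hdvd (by omega)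
    rw [← pow_one (cyclotomic d ℚ)]
    refine pow_dvd_num_of_primeVal_le (cyclotomic_prime_rat hd0) ?_
    rw [pow_one]
    exact (Valuation.map_sub _ _ _).trans (max_le (primeVal_cyclotomic_G_le hd0 hdvd h1)
      (primeVal_cyclotomic_qint_pow_le hd0 hdvd h1))
end

section
/- For every integer n > 1, the integer 2n·C(2n,n) divides Σ_{k=0}^{n-1} (6k^4/(2k-1)) · C(2k,k)^3 · 16^{n-k-1} (each summand 6k^4/(2k-1)·C(2k,k)^3·16^{n-k-1} is an integer, since (2k-1) divides C(2k,k)·k). -/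
open Finset

theorem succ_mul_centralBinom_succ_rat (n : ℕ) :
    ((n + 1).centralBinom : ℚ) = 2 * (2 * n + 1) / (n + 1) * n.centralBinom := by
  have h : ((n : ℚ) + 1) * (n + 1).centralBinom = 2 * (2 * n + 1) * n.centralBinom := by
    exact_mod_cast Nat.succ_mul_centralBinom_succ n
  field_simp
  linear_combination h

/-- The summand of `auxSum`, with the power of four written as a quotient. -/
def auxTerm (m i : ℕ) : ℚ :=
  i.centralBinom * (m + i).choose i * (4 ^ m / 4 ^ i)

/-- `∑ i ≤ m, C(2i,i) C(m+i,i) 4^(m-i)`. -/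
def auxSum (m : ℕ) : ℚ := ∑ i ∈ range (m + 1), auxTerm m i

theorem auxTerm_succ_left (m i : ℕ) :
    auxTerm (m + 1) i = 4 * (m + 1 + i) / (m + 1) * auxTerm m i := by
  have h : ((m + 1 + i).choose i : ℚ) * (m + 1) = (m + i).choose i * (m + 1 + i) := by
    have := Nat.choose_mul_succ_eq (m + i) i
    rw [show m + i + 1 - i = m + 1 by omega, show m + i + 1 = m + 1 + i by omega] at this
    exact_mod_cast this.symm
  unfold auxTerm
  field_simp
  rw [pow_succ]
  linear_combination 4 * (i.centralBinom : ℚ) * 4 ^ m * h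

theorem auxTerm_succ_right (m i : ℕ) :
    auxTerm m (i + 1) = (2 * i + 1) * (m + i + 1) / (2 * (i + 1) ^ 2) * auxTerm m i := by
  have h : ((m + (i + 1)).choose (i + 1) : ℚ) * (i + 1) = (m + i + 1) * (m + i).choose i := by
    exact_mod_cast (Nat.add_one_mul_choose_eq (m + i) i).symm
  unfold auxTerm
  rw [succ_mul_centralBinom_succ_rat, eq_div_of_mul_eq (by positivity) h, pow_succ]
  field_simp
  ring

theorem sum_auxTerm_telescope (m N : ℕ) :
    (2 * m + 3) * ∑ i ∈ range N, auxTerm (m + 1) i =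
      8 * (m + 1) * (∑ i ∈ range N, auxTerm m i) + 8 * N ^ 2 / (m + 1) * auxTerm m N := by
  induction N with
  | zero => simp
  | succ N ih =>
    rw [sum_range_succ, sum_range_succ, mul_add, ih, auxTerm_succ_left, auxTerm_succ_right]
    push_cast
    field_simp
    ring

theorem auxTerm_self (m : ℕ) : auxTerm m m = (m.centralBinom : ℚ) ^ 2 := by
  rw [auxTerm, ← two_mul, ← Nat.centralBinom_eq_two_mul_choose, div_self (by positivity)]
  ring

theorem auxSum_succ (m : ℕ) :
    (2 * m + 3) * auxSum (m + 1) =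
      8 * (m + 1) * auxSum m + (3 * m + 4) * ((m + 1).centralBinom : ℚ) ^ 2 := by
  have h := sum_auxTerm_telescope m (m + 1)
  have h' := auxTerm_succ_left m (m + 1)
  rw [auxTerm_self] at h'
  rw [auxSum, sum_range_succ, mul_add, h, auxTerm_self, auxSum, h']
  push_cast
  field_simp
  ring

theorem exists_auxSum_eq_four_mul (m : ℕ) (hm : 1 ≤ m) : ∃ z : ℤ, auxSum m = 4 * z := by
  obtain ⟨c, hc⟩ := Nat.two_dvd_centralBinom_of_one_le hm
  refine ⟨∑ i ∈ range m, i.centralBinom * (m + i).choose i * 4 ^ (m - i - 1) + c ^ 2, ?_⟩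
  rw [auxSum, sum_range_succ, auxTerm_self, hc]
  push_cast
  rw [mul_add, mul_sum]
  congr 1
  · refine sum_congr rfl fun i hi => ?_
    have hi := mem_range.1 hi
    obtain ⟨j, rfl⟩ := Nat.exists_eq_add_of_lt hi
    rw [auxTerm, show i + j + 1 - i - 1 = j by omega, pow_succ, pow_add]
    field_simp
  · ring

theorem sum_eq_auxSum (n : ℕ) :
    ∑ k ∈ range (n + 1),
        6 * (k : ℚ) ^ 4 / (2 * (k : ℚ) - 1) * (k.centralBinom : ℚ) ^ 3 * 16 ^ (n + 1 - k - 1) =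
      2 * (n + 1) * (n + 1).centralBinom *
        (((n - 1) * (2 * n + 1) * (n.centralBinom : ℚ) ^ 2 + auxSum n) / 4) := by
  induction n with
  | zero => simp [auxSum, auxTerm]
  | succ n ih =>
    have hs : ∑ k ∈ range (n + 1), 6 * (k : ℚ) ^ 4 / (2 * (k : ℚ) - 1) *
          (k.centralBinom : ℚ) ^ 3 * 16 ^ (n + 1 + 1 - k - 1) =
        16 * ∑ k ∈ range (n + 1), 6 * (k : ℚ) ^ 4 / (2 * (k : ℚ) - 1) *
          (k.centralBinom : ℚ) ^ 3 * 16 ^ (n + 1 - k - 1) := by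
      rw [mul_sum]
      refine sum_congr rfl fun k hk => ?_
      have hk := mem_range.1 hk
      rw [show n + 1 + 1 - k - 1 = n + 1 - k - 1 + 1 by omega, pow_succ]
      ring
    have hf : auxSum (n + 1) = (8 * (n + 1) * auxSum n +
        (3 * n + 4) * ((n + 1).centralBinom : ℚ) ^ 2) / (2 * n + 3) := by
      rw [eq_div_iff (by positivity), ← auxSum_succ]
      ring
    have hd : 2 * ((n + 1 : ℕ) : ℚ) - 1 = 2 * n + 1 := by push_cast; ring
    rw [sum_range_succ, hs, ih, hf, hd, succ_mul_centralBinom_succ_rat (n + 1),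
      succ_mul_centralBinom_succ_rat n, show n + 1 + 1 - (n + 1) - 1 = 0 by omega]
    push_cast
    field_simp
    ring

theorem two_mul_sub_one_dvd_centralBinom_mul (k : ℕ) :
    (2 * (k : ℤ) - 1) ∣ (k.centralBinom : ℤ) * k := by
  cases k with
  | zero => simp
  | succ k =>
    refine ⟨2 * k.centralBinom, ?_⟩
    have h : ((k : ℤ) + 1) * (k + 1).centralBinom = 2 * (2 * k + 1) * k.centralBinom := by
      exact_mod_cast Nat.succ_mul_centralBinom_succ k
    push_cast
    linear_combination h

theorem stmt_19 (n : ℕ) (hn : 1 < n) :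
    (∀ k < n, (2 * (k : ℤ) - 1) ∣ ((2 * k).choose k : ℤ) * k ∧
      ∃ z : ℤ, 6 * (k : ℚ) ^ 4 / (2 * (k : ℚ) - 1) * ((2 * k).choose k : ℚ) ^ 3 *
        16 ^ (n - k - 1) = (z : ℚ)) ∧
    ∃ z : ℤ, (∑ k ∈ Finset.range n,
        6 * (k : ℚ) ^ 4 / (2 * (k : ℚ) - 1) * ((2 * k).choose k : ℚ) ^ 3 * 16 ^ (n - k - 1)) =
      (2 * n * ((2 * n).choose n) : ℚ) * (z : ℚ) := by
  simp only [← Nat.centralBinom_eq_two_mul_choose]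
  refine ⟨fun k _ => ⟨two_mul_sub_one_dvd_centralBinom_mul k, ?_⟩, ?_⟩
  · obtain ⟨c, hc⟩ := two_mul_sub_one_dvd_centralBinom_mul k
    have hc' : (k.centralBinom : ℚ) * k = (2 * k - 1) * c := by exact_mod_cast hc
    have hk : 2 * (k : ℚ) - 1 ≠ 0 := by
      have : 2 * (k : ℤ) - 1 ≠ 0 := by omega
      exact_mod_cast this
    refine ⟨6 * k ^ 3 * k.centralBinom ^ 2 * c * 16 ^ (n - k - 1), ?_⟩
    push_cast
    rw [div_mul_eq_mul_div, div_mul_eq_mul_div, div_eq_iff hk]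
    linear_combination 6 * (k : ℚ) ^ 3 * k.centralBinom ^ 2 * 16 ^ (n - k - 1) * hc'
  · obtain ⟨m, rfl⟩ := Nat.exists_eq_add_of_lt hn
    obtain ⟨z, hz⟩ := exists_auxSum_eq_four_mul (1 + m) (by omega)
    obtain ⟨c, hc⟩ := Nat.two_dvd_centralBinom_of_one_le (n := 1 + m) (by omega)
    refine ⟨m * (2 * m + 3) * c ^ 2 + z, ?_⟩
    rw [sum_eq_auxSum, hz, hc]
    push_cast
    ring
end
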